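/- (Theorem 6, joint distribution of the MMU at initial prices and the equivalent variation.) Let p, p' : C → ℝ be price vectors, y ∈ ℝ an income, and EV : Ω → ℝ an equivalent variation. For i ∈ C let W_i ω be the money-metric utility of type ω at alternative i with price p i and reference prices p. Then for all i, j ∈ C and w, z ∈ ℝ: μ {ω | w ≤ W_i ω and EV ω ≤ z and i is weakly optimal for ω at (p, y) and j is weakly optimal for ω at (p', y)} equals P_{i,j}(p, min(p', p + z), y) if both p' j ≤ p j + z and w ≤ y, and equals 0 otherwise, where min denotes the componentwise minimum and p + z the vector with components p c + z. -/

import Mathlib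

open MeasureTheory
open scoped ENNReal BigOperators

/-- `i` is weakly optimal for type `ω` at price vector `p` and income `y`:
its utility is weakly largest among all alternatives. -/
def WeakOpt {Ω : Type*} {n : ℕ} (U : Ω → Fin n → ℝ → ℝ) (ω : Ω)
    (p : Fin n → ℝ) (y : ℝ) (i : Fin n) : Prop :=
  ∀ c, U ω c (y - p c) ≤ U ω i (y - p i)

/-- Choice probability `P_i(p, y)`. -/
noncomputable def ChoiceProb {Ω : Type*} [MeasurableSpace Ω] {n : ℕ}
    (μ : Measure Ω) (U : Ω → Fin n → ℝ → ℝ) (p : Fin n → ℝ) (y : ℝ) (i : Fin n) : ℝ≥0∞ :=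
  μ {ω | WeakOpt U ω p y i}

/-- Transition probability `P_{i,j}(p, p', y)`. -/
noncomputable def TransProb {Ω : Type*} [MeasurableSpace Ω] {n : ℕ}
    (μ : Measure Ω) (U : Ω → Fin n → ℝ → ℝ) (p p' : Fin n → ℝ) (y : ℝ) (i j : Fin n) : ℝ≥0∞ :=
  μ {ω | WeakOpt U ω p y i ∧ WeakOpt U ω p' y j}

/-- Regularity condition (R1): for every type, every pair of alternatives and every
residual numeraire level, sufficiently poor levels at `c'` are worse and sufficiently
rich levels at `c'` are better. -/
def Reg1 {Ω : Type*} {n : ℕ} (U : Ω → Fin n → ℝ → ℝ) : Prop :=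
  ∀ (ω : Ω) (c c' : Fin n) (m : ℝ),
    (∃ m₀ : ℝ, ∀ m' ≤ m₀, U ω c' m' < U ω c m) ∧
    (∃ m₁ : ℝ, ∀ m', m₁ ≤ m' → U ω c m < U ω c' m')

/-- Negligible ties (R2): at any price vector and income, the set of types indifferent
between two distinct alternatives has measure zero. -/
def Reg2 {Ω : Type*} [MeasurableSpace Ω] {n : ℕ} (μ : Measure Ω)
    (U : Ω → Fin n → ℝ → ℝ) : Prop :=
  ∀ (q : Fin n → ℝ) (y : ℝ) (c c' : Fin n), c ≠ c' →
    μ {ω | U ω c (y - q c) = U ω c' (y - q c')} = 0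

/-- A family of nested opportunity sets, described by an index set `Λ ⊆ ℝ`
and virtual prices `ptilde`. -/
structure NOSFamily {n : ℕ} (Λ : Set ℝ) (ptilde : ℝ → Fin n → ℝ) : Prop where
  nonempty : Λ.Nonempty
  closed : IsClosed Λ
  cont : ∀ c : Fin n, ContinuousOn (fun l => ptilde l c) Λ
  anti : ∀ l ∈ Λ, ∀ l' ∈ Λ, l < l' →
    (∀ c, ptilde l' c ≤ ptilde l c) ∧ ∃ c, ptilde l' c < ptilde l c
  unbddAbove : ∀ (c : Fin n) (M : ℝ), ∃ l ∈ Λ, M ≤ ptilde l c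
  unbddBelow : ∃ c : Fin n, ∀ M : ℝ, ∃ l ∈ Λ, ptilde l c ≤ M

/-- The NOS welfare measure of type `ω` at alternative `k` with price `pk`. -/
noncomputable def NOSWelfare {Ω : Type*} {n : ℕ} (U : Ω → Fin n → ℝ → ℝ)
    (Λ : Set ℝ) (ptilde : ℝ → Fin n → ℝ) (y : ℝ) (k : Fin n) (pk : ℝ) (ω : Ω) : ℝ :=
  sSup {l | l ∈ Λ ∧ ∀ c, U ω c (y - ptilde l c) ≤ U ω k (y - pk)}

/-- The money-metric utility of type `ω` at alternative `k` with price `pk`,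
income `y` and reference prices `r`. -/
noncomputable def MMU {Ω : Type*} {n : ℕ} (U : Ω → Fin n → ℝ → ℝ)
    (r : Fin n → ℝ) (y : ℝ) (k : Fin n) (pk : ℝ) (ω : Ω) : ℝ :=
  sSup {l : ℝ | ∀ c, U ω c (l - r c) ≤ U ω k (y - pk)}

/-- `CV` is a compensating variation for the price change from `p` to `p'` at income `y`. -/
def IsCV {Ω : Type*} {n : ℕ} (U : Ω → Fin n → ℝ → ℝ)
    (p p' : Fin n → ℝ) (y : ℝ) (CV : Ω → ℝ) : Prop :=
  ∀ ω, (⨆ c, U ω c (y - p c)) = ⨆ c, U ω c (y - p' c - CV ω)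

/-- `EV` is an equivalent variation for the price change from `p` to `p'` at income `y`. -/
def IsEV {Ω : Type*} {n : ℕ} (U : Ω → Fin n → ℝ → ℝ)
    (p p' : Fin n → ℝ) (y : ℝ) (EV : Ω → ℝ) : Prop :=
  ∀ ω, (⨆ c, U ω c (y - p c - EV ω)) = ⨆ c, U ω c (y - p' c)

/-- The money-metric utility at reference prices `r` equals the income whenever the alternative
is optimal at `r`. -/
lemma MMU_eq_of_weakOpt {Ω : Type*} {n : ℕ} {U : Ω → Fin n → ℝ → ℝ}
    (hMono : ∀ ω c, StrictMono (U ω c)) {r : Fin n → ℝ} {y : ℝ} {i : Fin n} {ω : Ω}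
    (h : WeakOpt U ω r y i) : MMU U r y i (r i) ω = y := by
  have hset : {l : ℝ | ∀ c, U ω c (l - r c) ≤ U ω i (y - r i)} = Set.Iic y := by
    ext l
    refine ⟨fun hl => ?_, fun hl c => ?_⟩
    · simpa using (hMono ω i).le_iff_le.1 (hl i)
    · exact ((hMono ω c).monotone (sub_le_sub_right hl _)).trans (h c)
  rw [MMU, hset, csSup_Iic]

/-- If `j` is optimal at the final prices, the equivalent variation is at most `z` exactly when
no alternative at initial prices and income `y - z` is better than `j` at the final prices. -/
lemma IsEV.le_iff_of_weakOpt {Ω : Type*} {n : ℕ} {U : Ω → Fin n → ℝ → ℝ}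
    (hMono : ∀ ω c, StrictMono (U ω c)) {p p' : Fin n → ℝ} {y : ℝ} {EV : Ω → ℝ}
    (hEV : IsEV U p p' y EV) {j : Fin n} {ω : Ω} (hj : WeakOpt U ω p' y j) (z : ℝ) :
    EV ω ≤ z ↔ ∀ c, U ω c (y - p c - z) ≤ U ω j (y - p' j) := by
  have : Nonempty (Fin n) := ⟨j⟩
  have hsup : (⨆ c, U ω c (y - p c - EV ω)) = U ω j (y - p' j) :=
    (hEV ω).trans (le_antisymm (ciSup_le hj)
      (le_ciSup (f := fun c => U ω c (y - p' c)) (Set.finite_range _).bddAbove j))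
  refine ⟨fun hz c => ?_, fun h => ?_⟩
  · rw [← hsup]
    exact ((hMono ω c).monotone (by linarith)).trans
      (le_ciSup (f := fun c => U ω c (y - p c - EV ω)) (Set.finite_range _).bddAbove c)
  · obtain ⟨c, hc⟩ := exists_eq_ciSup_of_finite (f := fun c => U ω c (y - p c - EV ω))
    have hle := (h c).trans_eq (hsup.symm.trans hc.symm)
    linarith [(hMono ω c).le_iff_le.1 hle]

/-- Optimality at the componentwise minimum of two price vectors, for an alternative whose
price attains the minimum at the first one. -/
lemma weakOpt_min_iff {Ω : Type*} {n : ℕ} {U : Ω → Fin n → ℝ → ℝ}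
    (hMono : ∀ ω c, StrictMono (U ω c)) {q q' : Fin n → ℝ} {y : ℝ} {j : Fin n} {ω : Ω}
    (hj : q j ≤ q' j) :
    WeakOpt U ω (fun c => min (q c) (q' c)) y j ↔
      WeakOpt U ω q y j ∧ ∀ c, U ω c (y - q' c) ≤ U ω j (y - q j) := by
  simp only [WeakOpt, min_eq_left hj, ← max_sub_sub_left, (hMono ω _).monotone.map_max,
    max_le_iff, forall_and]

/-- Theorem 6: joint distribution of the MMU (with initial prices as
reference prices) and the equivalent variation. -/
theorem mmu_ev_joint_distribution {Ω : Type*} [MeasurableSpace Ω] {n : ℕ} (hn : 0 < n)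
    (μ : Measure Ω) [IsProbabilityMeasure μ]
    (U : Ω → Fin n → ℝ → ℝ)
    (hCont : ∀ ω c, Continuous (U ω c))
    (hMono : ∀ ω c, StrictMono (U ω c))
    (hR1 : Reg1 U)
    (p p' : Fin n → ℝ) (y : ℝ) (EV : Ω → ℝ) (hEV : IsEV U p p' y EV)
    (i j : Fin n) (w z : ℝ) :
    μ {ω | w ≤ MMU U p y i (p i) ω ∧ EV ω ≤ z ∧
           WeakOpt U ω p y i ∧ WeakOpt U ω p' y j} =
      if p' j ≤ p j + z ∧ w ≤ y
      then TransProb μ U p (fun c => min (p' c) (p c + z)) y i j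
      else 0 := by
  split_ifs with h
  · obtain ⟨hpj, hw⟩ := h
    rw [TransProb]
    congr 1
    ext ω
    simp only [Set.mem_ofPred_eq, weakOpt_min_iff hMono (q' := fun c => p c + z) hpj,
      ← sub_sub]
    constructor
    · rintro ⟨-, hz, hi, hj⟩
      exact ⟨hi, hj, (hEV.le_iff_of_weakOpt hMono hj z).1 hz⟩
    · rintro ⟨hi, hj, hz⟩
      exact ⟨hw.trans_eq (MMU_eq_of_weakOpt hMono hi).symm,
        (hEV.le_iff_of_weakOpt hMono hj z).2 hz, hi, hj⟩
  · convert measure_empty (μ := μ)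
    rw [Set.eq_empty_iff_forall_notMem]
    rintro ω ⟨hw, hz, hi, hj⟩
    refine h ⟨?_, hw.trans_eq (MMU_eq_of_weakOpt hMono hi)⟩
    have hle := (hEV.le_iff_of_weakOpt hMono hj z).1 hz j
    linarith [(hMono ω j).le_iff_le.1 hle]
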